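/- Let N be a commutative group, m a maximal ideal of the monoid algebra ℚ[N], and l = ℚ[N]/m its residue field. Let L be a field equipped with a ring homomorphism ι : l → L, and let φ : N → Lˣ be the group homomorphism sending n to ι([n] mod m). Let m_L be the kernel of the L-algebra homomorphism L[N] → L determined by [n] ↦ φ(n). Then {n ∈ N : 1 − [n] ∈ m} = {n ∈ N : 1 − [n] ∈ m_L}; equivalently, the kernel of n ↦ [n] mod m in lˣ coincides with the kernel of φ : N → Lˣ. -/

import Mathlib

/-- Let `N` be a commutative group, `m` a maximal ideal of `ℚ[N]` with residue
field `l = ℚ[N]/m`, and `ι : l → L` a ring homomorphism into a field `L`. Let `ψ : L[N] → L`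
be the `L`-algebra homomorphism determined by `[n] ↦ ι([n] mod m)`, and `m_L = ker ψ`. Then
`{n | 1 - [n] ∈ m} = {n | 1 - [n] ∈ m_L}`. -/
theorem support_base_change (N : Type*) [AddCommGroup N]
    (m : Ideal (AddMonoidAlgebra ℚ N)) [m.IsMaximal]
    (L : Type*) [Field L] (ι : (AddMonoidAlgebra ℚ N ⧸ m) →+* L)
    (ψ : AddMonoidAlgebra L N →ₐ[L] L)
    (hψ : ∀ n : N, ψ (AddMonoidAlgebra.single n (1 : L))
      = ι (Ideal.Quotient.mk m (AddMonoidAlgebra.single n (1 : ℚ)))) :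
    {n : N | 1 - AddMonoidAlgebra.single n (1 : ℚ) ∈ m}
      = {n : N | 1 - AddMonoidAlgebra.single n (1 : L) ∈ RingHom.ker ψ} := by
  let := Ideal.Quotient.field m
  have hι : Function.Injective ι := ι.injective
  ext n
  rw [Set.mem_ofPred_eq, Set.mem_ofPred_eq, RingHom.mem_ker, map_sub, map_one, hψ,
    ← Ideal.Quotient.eq_zero_iff_mem, map_sub, map_one, ← map_eq_zero_iff ι hι, map_sub, map_one]
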